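/- Let k be a field, char(k) ∤ l, with primitive l-th root of unity, and let μ_l act on B = k[z,w]/(zw - t) by (z,w) ↦ (ζz, ζ^{-1}w). Let b be an integer with gcd(b,l) = 1, set a = l - b, and let M = B·s be the free rank-one B-module with ζ·s = ζ^b s (semilinearly). Then the invariant submodule M^{μ_l} over A = B^{μ_l} = k[x,y]/(xy - t^l) (x = z^l, y = w^l) is generated by u = z^a s and v = w^b s, and these satisfy the relations y·u = t^a·v and x·v = t^b·u. -/

import Mathlib

set_option synthInstance.maxHeartbeats 1000000
set_option maxHeartbeats 1000000

open MvPolynomial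

namespace stmt18

/-- The `μ_l`-action on representatives: the `k`-algebra endomorphism of `k[z,w]`
sending `z ↦ ξ z`, `w ↦ ξ⁻¹ w`. -/
noncomputable def σ {k : Type*} [Field k] (ξ : k) :
    MvPolynomial (Fin 2) k →ₐ[k] MvPolynomial (Fin 2) k :=
  aeval ![ξ • X 0, ξ⁻¹ • X 1]

/-- The ideal `(zw - t)` of `k[z,w]`. -/
noncomputable abbrev nodeIdeal {k : Type*} [Field k] (t : k) : Ideal (MvPolynomial (Fin 2) k) :=
  Ideal.span {(X 0 * X 1 - C t : MvPolynomial (Fin 2) k)}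

/-- The coordinate ring `k[z,w]/(zw - t)`. -/
abbrev NodeRing {k : Type*} [Field k] (t : k) : Type _ :=
  MvPolynomial (Fin 2) k ⧸ nodeIdeal t

/-- The image of `z` in `k[z,w]/(zw - t)`. -/
noncomputable def nodeZ {k : Type*} [Field k] (t : k) : NodeRing t :=
  Ideal.Quotient.mk (nodeIdeal t) (X 0)

/-- The image of `w` in `k[z,w]/(zw - t)`. -/
noncomputable def nodeW {k : Type*} [Field k] (t : k) : NodeRing t :=
  Ideal.Quotient.mk (nodeIdeal t) (X 1)

theorem nodeZ_mul_nodeW {k : Type*} [Field k] (t : k) :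
    nodeZ t * nodeW t = algebraMap k (NodeRing t) t := by
  rw [nodeZ, nodeW, ← map_mul]
  exact Ideal.Quotient.eq.mpr (Ideal.subset_span rfl)

/-- The automorphism of `k[z,w]/(zw - t)` induced by `σ ξ`. -/
noncomputable def nodeσ {k : Type*} [Field k] (t : k) {ξ : k} (hξ : ξ ≠ 0) :
    NodeRing t →ₐ[k] NodeRing t :=
  Ideal.Quotient.liftₐ (nodeIdeal t) ((Ideal.Quotient.mkₐ k (nodeIdeal t)).comp (σ ξ)) (by
    intro p hp
    rw [← RingHom.mem_ker]
    refine (Ideal.span_le (I := RingHom.ker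
      ((Ideal.Quotient.mkₐ k (nodeIdeal t)).comp (σ ξ)))).mpr ?_ hp
    rintro _ rfl
    have h : σ ξ (X 0 * X 1 - C t) = X 0 * X 1 - C t := by
      simp [σ, algHom_C, algebraMap_eq, smul_smul, inv_mul_cancel₀ hξ]
    rw [SetLike.mem_coe, RingHom.mem_ker, AlgHom.comp_apply, h]
    exact Ideal.Quotient.eq_zero_iff_mem.mpr (Ideal.subset_span rfl))

section
variable {k : Type*} [Field k] (t : k)

theorem nodeσ_mk {ξ : k} (hξ : ξ ≠ 0) (p : MvPolynomial (Fin 2) k) :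
    nodeσ t hξ (Ideal.Quotient.mk (nodeIdeal t) p) = Ideal.Quotient.mk (nodeIdeal t) (σ ξ p) :=
  rfl

theorem nodeσ_nodeZ {ξ : k} (hξ : ξ ≠ 0) : nodeσ t hξ (nodeZ t) = ξ • nodeZ t := by
  rw [nodeZ, nodeσ_mk, σ, aeval_X]
  rfl

theorem nodeσ_nodeW {ξ : k} (hξ : ξ ≠ 0) : nodeσ t hξ (nodeW t) = ξ⁻¹ • nodeW t := by
  rw [nodeW, nodeσ_mk, σ, aeval_X]
  rfl

/-- The subalgebra of `k[z,w]/(zw - t)` generated by `z^l` and `w^l`. -/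
noncomputable def powSubalgebra (l : ℕ) : Subalgebra k (NodeRing t) :=
  Algebra.adjoin k {nodeZ t ^ l, nodeW t ^ l}

/-- The `k`-subspace `A z^(l-b) + A w^b`, where `A` is generated by `z^l` and `w^l`. -/
noncomputable def genSubmodule (l b : ℕ) : Submodule k (NodeRing t) where
  carrier := {m | ∃ c ∈ powSubalgebra t l, ∃ d ∈ powSubalgebra t l,
    m = c * nodeZ t ^ (l - b) + d * nodeW t ^ b}
  add_mem' := by
    rintro _ _ ⟨c, hc, d, hd, rfl⟩ ⟨c', hc', d', hd', rfl⟩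
    exact ⟨c + c', add_mem hc hc', d + d', add_mem hd hd', by ring⟩
  zero_mem' := ⟨0, zero_mem _, 0, zero_mem _, by simp⟩
  smul_mem' := by
    rintro r _ ⟨c, hc, d, hd, rfl⟩
    exact ⟨r • c, Subalgebra.smul_mem _ hc r, r • d, Subalgebra.smul_mem _ hd r, by
      rw [smul_add, smul_mul_assoc, smul_mul_assoc]⟩

theorem nodeσ_eq_self_of_mem_powSubalgebra {l : ℕ} {ξ : k} (hξ : ξ ≠ 0) (hξl : ξ ^ l = 1)
    {c : NodeRing t} (hc : c ∈ powSubalgebra t l) : nodeσ t hξ c = c := by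
  have h : powSubalgebra t l ≤ AlgHom.equalizer (nodeσ t hξ) (AlgHom.id k (NodeRing t)) := by
    refine Algebra.adjoin_le ?_
    rintro _ (rfl | rfl) <;>
      simp [nodeσ_nodeZ, nodeσ_nodeW, smul_pow, hξl]
  exact h hc

theorem smul_nodeσ_eq_self_of_mem_genSubmodule {l b : ℕ} (hbl : b ≤ l) {ξ : k} (hξ : ξ ≠ 0)
    (hξl : ξ ^ l = 1) {m : NodeRing t} (hm : m ∈ genSubmodule t l b) :
    ξ ^ b • nodeσ t hξ m = m := by
  obtain ⟨c, hc, d, hd, rfl⟩ := hm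
  have h₁ : ξ ^ b * ξ ^ (l - b) = 1 := by rw [← pow_add, Nat.add_sub_cancel' hbl, hξl]
  have h₂ : ξ ^ b * ξ⁻¹ ^ b = 1 := by rw [← mul_pow, mul_inv_cancel₀ hξ, one_pow]
  rw [map_add, map_mul, map_mul, map_pow, map_pow, nodeσ_nodeZ, nodeσ_nodeW,
    nodeσ_eq_self_of_mem_powSubalgebra t hξ hξl hc,
    nodeσ_eq_self_of_mem_powSubalgebra t hξ hξl hd, smul_pow, smul_pow, smul_add,
    mul_smul_comm, mul_smul_comm, smul_smul, smul_smul, h₁, h₂, one_smul, one_smul]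

theorem nodeZ_pow_mul_nodeW_pow_mem_genSubmodule {l b : ℕ} (hbl : b < l) {i j : ℕ}
    (hij : b + i ≡ j [MOD l]) : nodeZ t ^ i * nodeW t ^ j ∈ genSubmodule t l b := by
  have hz (q : ℕ) : (nodeZ t ^ l) ^ q ∈ powSubalgebra t l :=
    pow_mem (Algebra.subset_adjoin (by simp)) q
  have hw (q : ℕ) : (nodeW t ^ l) ^ q ∈ powSubalgebra t l :=
    pow_mem (Algebra.subset_adjoin (by simp)) q
  have hzw (n : ℕ) : nodeZ t ^ n * nodeW t ^ n = algebraMap k (NodeRing t) (t ^ n) := by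
    rw [← mul_pow, nodeZ_mul_nodeW, map_pow]
  rcases le_or_gt i j with h | h
  · obtain ⟨n, rfl⟩ := Nat.exists_eq_add_of_le h
    have hn : b ≡ n [MOD l] := Nat.ModEq.add_right_cancel' i (by rwa [add_comm n i])
    have hn' : n = b + l * (n / l) := by
      have h₁ := Nat.mod_add_div n l
      rw [← hn, Nat.mod_eq_of_lt hbl] at h₁
      exact h₁.symm
    rw [pow_add, ← mul_assoc, hzw, ← Algebra.smul_def]
    refine Submodule.smul_mem _ _ ⟨0, zero_mem _, _, hw (n / l), ?_⟩
    rw [zero_mul, zero_add, ← pow_mul, ← pow_add, add_comm _ b, ← hn']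
  · obtain ⟨n, rfl⟩ := Nat.exists_eq_add_of_le h.le
    have hn : b + n ≡ 0 [MOD l] :=
      Nat.ModEq.add_right_cancel' j (by rwa [zero_add, add_assoc, add_comm n j])
    obtain ⟨q, hq⟩ := (Nat.modEq_zero_iff_dvd).mp hn
    obtain ⟨q, rfl⟩ : ∃ r, q = r + 1 := Nat.exists_eq_succ_of_ne_zero (by
      rintro rfl
      omega)
    have hn' : n = l * q + (l - b) := by
      rw [mul_add] at hq
      omega
    rw [pow_add, mul_right_comm, hzw, ← Algebra.smul_def]
    refine Submodule.smul_mem _ _ ⟨_, hz q, 0, zero_mem _, ?_⟩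
    rw [zero_mul, add_zero, ← pow_mul, ← pow_add, ← hn']

theorem mk_monomial (e : Fin 2 →₀ ℕ) (c : k) :
    Ideal.Quotient.mk (nodeIdeal t) (monomial e c) = c • (nodeZ t ^ e 0 * nodeW t ^ e 1) := by
  have h : monomial e c = c • ((X 0 : MvPolynomial (Fin 2) k) ^ e 0 * X 1 ^ e 1) := by
    rw [monomial_eq, smul_eq_C_mul, Finsupp.prod_fintype _ _ (by simp), Fin.prod_univ_two]
  rw [h]
  rfl

theorem sum_smul_nodeσ_mem_genSubmodule {l b : ℕ} (hbl : b < l) {ζ : k}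
    (hζ : IsPrimitiveRoot ζ l) (hζ₀ : ζ ≠ 0) (m : NodeRing t) :
    ∑ n ∈ Finset.range l, (ζ ^ n) ^ b • nodeσ t (pow_ne_zero n hζ₀) m ∈ genSubmodule t l b := by
  obtain ⟨p, rfl⟩ := Ideal.Quotient.mk_surjective m
  induction p using MvPolynomial.induction_on' with
  | monomial e c =>
    set r : k := ζ ^ (b + e 0) * ζ⁻¹ ^ e 1 with hr
    have hterm (n : ℕ) : (ζ ^ n) ^ b • nodeσ t (pow_ne_zero n hζ₀)
        (Ideal.Quotient.mk (nodeIdeal t) (monomial e c)) =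
        r ^ n • c • (nodeZ t ^ e 0 * nodeW t ^ e 1) := by
      rw [mk_monomial, map_smul, map_mul, map_pow, map_pow, nodeσ_nodeZ, nodeσ_nodeW,
        smul_pow, smul_pow, smul_mul_smul_comm, smul_comm c, smul_smul]
      congr 1
      rw [hr]
      ring
    rw [Finset.sum_congr rfl fun n _ => hterm n, ← Finset.sum_smul]
    by_cases h : r = 1
    · refine Submodule.smul_mem _ _ (Submodule.smul_mem _ _
        (nodeZ_pow_mul_nodeW_pow_mem_genSubmodule t hbl ?_))
      have h' : ζ ^ (b + e 0) = ζ ^ e 1 := by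
        rw [hr, inv_pow] at h
        exact (mul_inv_eq_one₀ (pow_ne_zero _ hζ₀)).mp h
      have hfin : IsOfFinOrder ζ :=
        isOfFinOrder_iff_pow_eq_one.mpr ⟨l, Nat.zero_lt_of_lt hbl, hζ.pow_eq_one⟩
      rw [hζ.eq_orderOf]
      exact hfin.pow_eq_pow_iff_modEq.mp h'
    · have hrl : r ^ l = 1 := by
        rw [hr, mul_pow, ← pow_mul, ← pow_mul, mul_comm _ l, mul_comm _ l, pow_mul, pow_mul,
          inv_pow, hζ.pow_eq_one, inv_one, one_pow, one_pow, one_mul]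
      have hsum : ∑ n ∈ Finset.range l, r ^ n = 0 := by
        rw [geom_sum_eq h, hrl, sub_self, zero_div]
      rw [hsum, zero_smul]
      exact zero_mem _
  | add p q hp hq =>
    simp only [map_add, smul_add, Finset.sum_add_distrib]
    exact add_mem hp hq

theorem mem_genSubmodule_of_forall_smul_nodeσ_eq_self {l b : ℕ} (hbl : b < l) {ζ : k}
    (hζ : IsPrimitiveRoot ζ l) {m : NodeRing t}
    (hm : ∀ (ξ : k) (hξ : ξ ≠ 0), ξ ^ l = 1 → ξ ^ b • nodeσ t hξ m = m) :
    m ∈ genSubmodule t l b := by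
  have : NeZero l := ⟨by omega⟩
  have hζ₀ : ζ ≠ 0 := hζ.ne_zero (NeZero.ne l)
  have hl : (l : k) ≠ 0 := (hζ.neZero').out
  have h := sum_smul_nodeσ_mem_genSubmodule t hbl hζ hζ₀ m
  rw [Finset.sum_congr rfl fun n _ => hm (ζ ^ n) (pow_ne_zero n hζ₀) (by
    rw [← pow_mul, mul_comm, pow_mul, hζ.pow_eq_one, one_pow]), Finset.sum_const,
    Finset.card_range, ← Nat.cast_smul_eq_nsmul k] at h
  exact (Submodule.smul_mem_iff _ hl).mp h

end

/-- let `μ_l` act on `B = k[z,w]/(zw - t)` by `(z,w) ↦ (ζz, ζ⁻¹w)`, let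
`gcd(b,l) = 1`, `a = l - b`, and let `M = B·s` be free of rank one with `ζ·s = ζ^b s`
(identifying `M` with `B` via `s ↔ 1`, the semilinear action is `f ↦ ζ^b·f(ζz,ζ⁻¹w)`,
expressed here on representatives via `σ`).  Then the invariant submodule `M^{μ_l}` over
`A = B^{μ_l} = k[x,y]/(xy - t^l)` (with `x = z^l`, `y = w^l`, realized as the subalgebra
`S` generated by `z^l` and `w^l`) is generated by `u = z^a s` and `v = w^b s`, and these
satisfy `y·u = t^a·v` and `x·v = t^b·u`. -/
theorem stmt18 (k : Type*) [Field k] (l : ℕ) (hl : 0 < l) (ζ : k)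
    (hζ : IsPrimitiveRoot ζ l) (t : k) (b : ℕ) (hb : Nat.Coprime b l) (hbl : b < l) :
    letI P := MvPolynomial (Fin 2) k
    letI I : Ideal P := Ideal.span {(X 0 * X 1 - C t : P)}
    letI B := P ⧸ I
    letI mk : P →+* B := Ideal.Quotient.mk I
    letI a := l - b
    letI u : B := mk (X 0 ^ a)
    letI v : B := mk (X 1 ^ b)
    letI S : Subalgebra k B := Algebra.adjoin k {mk (X 0 ^ l), mk (X 1 ^ l)}
    ({m : B | ∀ ξ : k, ξ ^ l = 1 → ∀ p : P, mk p = m → mk (ξ ^ b • σ ξ p) = m}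
        = {m : B | ∃ c ∈ S, ∃ d ∈ S, m = c * u + d * v}) ∧
      mk (X 1 ^ l) * u = mk (C t) ^ a * v ∧
      mk (X 0 ^ l) * v = mk (C t) ^ b * u := by
  have hinv (m : NodeRing t) :
      (∀ ξ : k, ξ ^ l = 1 → ∀ p, Ideal.Quotient.mk (nodeIdeal t) p = m →
        Ideal.Quotient.mk (nodeIdeal t) (ξ ^ b • σ ξ p) = m) ↔ m ∈ genSubmodule t l b := by
    refine ⟨fun h => mem_genSubmodule_of_forall_smul_nodeσ_eq_self t hbl hζ ?_, ?_⟩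
    · intro ξ hξ hξl
      obtain ⟨p, rfl⟩ := Ideal.Quotient.mk_surjective m
      exact h ξ hξl p rfl
    · rintro hm ξ hξl p rfl
      have hξ : ξ ≠ 0 := by
        rintro rfl
        simp [hl.ne'] at hξl
      exact smul_nodeσ_eq_self_of_mem_genSubmodule t hbl.le hξ hξl hm
  refine ⟨Set.ext hinv, ?_, ?_⟩
  · change nodeW t ^ l * nodeZ t ^ (l - b) =
      algebraMap k (NodeRing t) t ^ (l - b) * nodeW t ^ b
    rw [← nodeZ_mul_nodeW, mul_pow, mul_assoc, ← pow_add, Nat.sub_add_cancel hbl.le, mul_comm]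
  · change nodeZ t ^ l * nodeW t ^ b =
      algebraMap k (NodeRing t) t ^ b * nodeZ t ^ (l - b)
    rw [← nodeZ_mul_nodeW, mul_pow, mul_right_comm, ← pow_add, Nat.add_sub_cancel' hbl.le]

end stmt18
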